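/- arXiv:2307.13976 — 2 statements merged into one kernel-verified Lean document; each statement's English description precedes it below -/
import Mathlib

section
/- Let G be a finite group with O_r(G) = 1 and O_{r'}(G) ⊄ Φ(G), and let R be a Sylow r-subgroup which is not normal in G. If R is contained in a unique maximal subgroup H of G, then G = P ⋊ R where P = O_{r'}(G) is a p-group for some prime p ≠ r, R acts faithfully and irreducibly on P/Φ(P), H = Φ(P)R, and the core of H in G is Φ(P) = Φ(G). -/
open Subgroup

/-- In a finite `p`-group, every maximal subgroup is normal. -/
theorem IsPGroup.normal_of_isCoatom {N : Type*} [Group N] [Finite N] {p : ℕ} [Fact p.Prime]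
    (hN : IsPGroup p N) {M : Subgroup N} (hM : IsCoatom M) : M.Normal :=
  have := hN.isNilpotent
  NormalizerCondition.normal_of_coatom M Group.normalizerCondition_of_isNilpotent hM

/-- In a finite `p`-group, every maximal subgroup has index `p`. -/
theorem IsPGroup.index_of_isCoatom {N : Type*} [Group N] [Finite N] {p : ℕ} [Fact p.Prime]
    (hN : IsPGroup p N) {M : Subgroup N} (hM : IsCoatom M) : M.index = p := by
  have hp : p.Prime := Fact.out
  obtain ⟨n, hn⟩ := IsPGroup.iff_card.mp (hN.to_subgroup M)
  obtain ⟨k, hk⟩ := hN.index M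
  have hcard := M.card_mul_index
  have hk0 : k ≠ 0 := by
    rintro rfl
    exact hM.1 (index_eq_one.mp (by simpa using hk))
  obtain ⟨K, hK, hMK⟩ := Sylow.exists_subgroup_card_pow_succ (n := n) (p := p)
    (by rw [← hcard, hn, hk, ← pow_add]; exact pow_dvd_pow _ (by omega)) hn
  have hMK' : M < K := lt_of_le_of_ne hMK (by
    rintro rfl
    have := Nat.pow_right_injective hp.two_le (hn.symm.trans hK)
    omega)
  have hK' := hM.2 K hMK'
  rw [hK', card_top, ← hcard, hn, pow_succ] at hK
  exact Nat.eq_of_mul_eq_mul_left (pow_pos hp.pos n) hK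

/-- The Frattini quotient of a finite `p`-group is abelian. -/
theorem IsPGroup.commutator_le_frattini {N : Type*} [Group N] [Finite N] {p : ℕ} [Fact p.Prime]
    (hN : IsPGroup p N) : commutator N ≤ frattini N := by
  rw [frattini, Order.radical]
  refine le_iInf₂ fun M hM => ?_
  have := hN.normal_of_isCoatom hM
  have : IsCyclic (N ⧸ M) := isCyclic_of_prime_card (p := p) (hN.index_of_isCoatom hM)
  rw [← Normal.quotient_commutative_iff_commutator_le]
  exact IsCyclic.isMulCommutative

/-- The Frattini quotient of a finite `p`-group has exponent dividing `p`. -/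
theorem IsPGroup.pow_mem_frattini {N : Type*} [Group N] [Finite N] {p : ℕ} [Fact p.Prime]
    (hN : IsPGroup p N) (x : N) : x ^ p ∈ frattini N := by
  rw [frattini, Order.radical]
  simp only [mem_iInf]
  intro M hM
  have := hN.normal_of_isCoatom hM
  rw [← hN.index_of_isCoatom hM]
  exact M.pow_index_mem x

/-- **Maschke's theorem** for a finite group acting coprimely on an elementary abelian group. -/
theorem Subgroup.exists_isCompl_invariant {A Γ : Type*} [CommGroup A] [Group Γ] [Finite Γ]
    {p : ℕ} [Fact p.Prime] [Module (ZMod p) (Additive A)] (hΓ : ¬ p ∣ Nat.card Γ)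
    (φ : Γ →* Monoid.End A) (D : Subgroup A) (hD : ∀ g, ∀ a ∈ D, φ g a ∈ D) :
    ∃ E : Subgroup A, IsCompl D E ∧ ∀ g, ∀ a ∈ E, φ g a ∈ E := by
  let f (g : Γ) : Additive A →+ Additive A :=
    AddMonoidHom.mk' (fun a => Additive.ofMul (φ g a.toMul))
      fun a b => congrArg Additive.ofMul (map_mul (φ g) a.toMul b.toMul)
  let ρ : Γ →* Module.End (ZMod p) (Additive A) :=
    { toFun := fun g => AddMonoidHom.toZModLinearMap p (f g)
      map_one' := by
        ext a
        exact congrArg Additive.ofMul (DFunLike.congr_fun (map_one φ) a.toMul)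
      map_mul' := fun g h => by
        ext a
        exact congrArg Additive.ofMul (DFunLike.congr_fun (map_mul φ g h) a.toMul) }
  have : NeZero (Nat.card Γ : ZMod p) := ⟨by rwa [Ne, ZMod.natCast_eq_zero_iff]⟩
  let W : Subrepresentation (ρ : Representation (ZMod p) Γ (Additive A)) :=
    { toSubmodule :=
        { carrier := {v | v.toMul ∈ D}
          zero_mem' := D.one_mem
          add_mem' := fun ha hb => D.mul_mem ha hb
          smul_mem' := fun c _ ha => ZMod.smul_mem (K := toAddSubgroup D) ha c }
      apply_mem_toSubmodule := fun g v hv => hD g v.toMul hv }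
  obtain ⟨E, hE⟩ : ∃ E : Subrepresentation (ρ : Representation (ZMod p) Γ (Additive A)),
      W ⊓ E = ⊥ ∧ W ⊔ E = ⊤ :=
    (exists_isCompl W).imp fun _ h => ⟨h.inf_eq_bot, h.sup_eq_top⟩
  let E' : Subgroup A :=
    { carrier := {a | Additive.ofMul a ∈ E.toSubmodule}
      one_mem' := E.toSubmodule.zero_mem
      mul_mem' := fun ha hb => E.toSubmodule.add_mem ha hb
      inv_mem' := fun ha => E.toSubmodule.neg_mem ha }
  refine ⟨E', ?_, fun g a ha => E.apply_mem_toSubmodule g (v := Additive.ofMul a) ha⟩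
  rw [isCompl_iff, disjoint_iff, codisjoint_iff]
  constructor
  · refine (eq_bot_iff_forall _).mpr fun a ha => ?_
    have hmem : Additive.ofMul a ∈ W ⊓ E := ha
    rw [hE.1] at hmem
    exact congrArg Additive.toMul ((Submodule.mem_bot (ZMod p)).mp hmem)
  · refine (eq_top_iff' _).mpr fun a => ?_
    have hmem : Additive.ofMul a ∈ W ⊔ E := by
      rw [hE.2]
      exact Submodule.mem_top (R := ZMod p)
    obtain ⟨b, hb, c, hc, hbc⟩ := Submodule.mem_sup.mp hmem
    exact mem_sup.mpr ⟨b.toMul, hb, c.toMul, hc, congrArg Additive.toMul hbc⟩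

/-- If a finite group acts coprimely on a finite `p`-group `N`, then every invariant subgroup
containing the Frattini subgroup has an invariant complement modulo the Frattini subgroup. -/
theorem IsPGroup.exists_invariant_complement_frattini {N Γ : Type*} [Group N] [Finite N] [Group Γ]
    [Finite Γ] {p : ℕ} [Fact p.Prime] (hN : IsPGroup p N) (hΓ : ¬ p ∣ Nat.card Γ)
    (φ : Γ →* MulAut N) (D : Subgroup N) (hFD : frattini N ≤ D) (hD : ∀ g, ∀ a ∈ D, φ g a ∈ D) :
    ∃ E : Subgroup N, frattini N ≤ E ∧ (∀ g, ∀ a ∈ E, φ g a ∈ E) ∧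
      D ⊓ E = frattini N ∧ D ⊔ E = ⊤ := by
  have hcomm := Normal.quotient_commutative_iff_commutator_le.mpr hN.commutator_le_frattini
  let : CommGroup (N ⧸ frattini N) :=
    { (inferInstance : Group (N ⧸ frattini N)) with mul_comm := fun a b => hcomm.is_comm.comm a b }
  let π := QuotientGroup.mk' (frattini N)
  have hπ : Function.Surjective π := QuotientGroup.mk'_surjective _
  have hφ : ∀ g, frattini N ≤ (frattini N).comap (φ g).toMonoidHom := fun g =>
    (characteristic_iff_le_comap.mp inferInstance) (φ g)
  let ψ : Γ →* Monoid.End (N ⧸ frattini N) :=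
    { toFun := fun g => QuotientGroup.map _ _ (φ g).toMonoidHom (hφ g)
      map_one' := by
        ext a
        induction a using QuotientGroup.induction_on
        exact congrArg π (DFunLike.congr_fun (map_one φ) _)
      map_mul' := fun g h => by
        ext a
        induction a using QuotientGroup.induction_on
        exact congrArg π (DFunLike.congr_fun (map_mul φ g h) _) }
  have hker : π.ker = frattini N := QuotientGroup.ker_mk' _
  have hDπ : (D.map π).comap π = D := comap_map_eq_self (hker.le.trans hFD)
  have hexp : ∀ a : N ⧸ frattini N, a ^ p = 1 := fun a => by
    obtain ⟨x, rfl⟩ := hπ a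
    rw [← map_pow]
    exact (QuotientGroup.eq_one_iff _).mpr (hN.pow_mem_frattini x)
  let : Module (ZMod p) (Additive (N ⧸ frattini N)) :=
    AddCommGroup.zmodModule fun a => congrArg Additive.ofMul (hexp a.toMul)
  obtain ⟨E, hE, hEinv⟩ := Subgroup.exists_isCompl_invariant (p := p) hΓ ψ (D.map π) (by
      rintro g _ ⟨a, ha, rfl⟩
      exact ⟨φ g a, hD g a ha, rfl⟩)
  refine ⟨E.comap π, hker.ge.trans (π.ker_le_comap E), fun g a ha => ?_, ?_, ?_⟩
  · exact hEinv g _ ha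
  · rw [← hDπ, ← comap_inf, hE.inf_eq_bot, MonoidHom.comap_bot, hker]
  · rw [← hDπ, comap_sup_eq _ _ _ hπ, hE.sup_eq_top, comap_top]

/-- A supplement of a finite normal subgroup `K` has index dividing the order of `K`. -/
theorem Subgroup.index_dvd_card_of_sup_eq_top {G : Type*} [Group G] [Finite G] {M K : Subgroup G}
    [K.Normal] (h : M ⊔ K = ⊤) : M.index ∣ Nat.card K := by
  have h1 : K.index = K.relIndex M := by
    rw [← relIndex_sup_right, h, relIndex_top_right]
  have h2 := K.card_mul_index
  have h3 := M.card_mul_index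
  have h4 : Nat.card (K ⊓ M : Subgroup G) * K.relIndex M = Nat.card M := by
    rw [← relIndex_bot_left, ← relIndex_bot_left, ← inf_relIndex_right K M]
    exact relIndex_mul_relIndex _ _ _ bot_le inf_le_right
  have h5 : 0 < K.index := Nat.pos_of_ne_zero K.index_ne_zero_of_finite
  refine ⟨Nat.card (K ⊓ M : Subgroup G), Nat.eq_of_mul_eq_mul_right h5 ?_⟩
  rw [h2, ← h3, ← h4, h1]
  ring

/-- An `r`-subgroup is conjugate into every supplement of a normal subgroup of order prime to `r`. -/
theorem IsPGroup.exists_conj_mem_of_sup_eq_top {G : Type*} [Group G] [Finite G] {r : ℕ}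
    [Fact r.Prime] {R : Subgroup G} (hR : IsPGroup r R) {M K : Subgroup G} [K.Normal]
    (hK : (Nat.card K).Coprime r) (h : M ⊔ K = ⊤) : ∃ g : G, ∀ x ∈ R, g⁻¹ * x * g ∈ M := by
  have hr : r.Prime := Fact.out
  obtain ⟨a, ha⟩ := hR.nonempty_fixed_point_of_prime_not_dvd_card (G ⧸ M) (fun hd =>
    (Nat.Prime.coprime_iff_not_dvd hr).mp hK.symm (hd.trans (index_dvd_card_of_sup_eq_top h)))
  obtain ⟨g, rfl⟩ := QuotientGroup.mk_surjective a
  refine ⟨g, fun x hx => ?_⟩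
  have h1 : ((x * g : G) : G ⧸ M) = (g : G ⧸ M) := ha ⟨x, hx⟩
  have h2 := M.inv_mem (QuotientGroup.eq.mp h1)
  simpa [mul_assoc] using h2

/-- If `H` is the only maximal subgroup containing the `r`-subgroup `R`, then every normal
subgroup of order prime to `r` contained in `H` lies in the Frattini subgroup. -/
theorem IsPGroup.le_frattini_of_le_unique_coatom {G : Type*} [Group G] [Finite G] {r : ℕ}
    [Fact r.Prime] {R : Subgroup G} (hR : IsPGroup r R) {H : Subgroup G}
    (huniq : ∀ H' : Subgroup G, IsCoatom H' → R ≤ H' → H' = H) {K : Subgroup G} [K.Normal]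
    (hK : (Nat.card K).Coprime r) (hKH : K ≤ H) : K ≤ frattini G := by
  rw [frattini, Order.radical]
  refine le_iInf₂ fun M hM => ?_
  by_contra hKM
  have hMK : M ⊔ K = ⊤ := hM.2 _ (left_lt_sup.mpr hKM)
  obtain ⟨g, hg⟩ := hR.exists_conj_mem_of_sup_eq_top hK hMK
  have hmem : ∀ x, x ∈ (MulAut.conj g).mapSubgroup M ↔ g⁻¹ * x * g ∈ M := fun x => by
    change x ∈ M.map (MulAut.conj g).toMonoidHom ↔ _
    rw [mem_map_equiv, MulAut.conj_symm_apply]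
  have hH := huniq _ ((OrderIso.isCoatom_iff _ M).mpr hM) fun x hx => (hmem x).mpr (hg x hx)
  refine hKM fun x hx => ?_
  have h1 := hKH (‹K.Normal›.conj_mem x hx g)
  rw [← hH, hmem] at h1
  simpa [mul_assoc] using h1

/-- A finite group acting coprimely by conjugation normalizes a Sylow subgroup. -/
theorem IsPGroup.exists_sylow_invariant {G : Type*} [Group G] [Finite G] {r : ℕ}
    [Fact r.Prime] {R : Subgroup G} (hR : IsPGroup r R) {P : Subgroup G} [P.Normal]
    (hP : (Nat.card P).Coprime r) (p : ℕ) [Fact p.Prime] :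
    ∃ Q : Subgroup G, Q ≤ P ∧ Nat.card Q = p ^ (Nat.card P).factorization p ∧
      ∀ x ∈ R, ∀ m ∈ Q, x * m * x⁻¹ ∈ Q := by
  obtain ⟨S⟩ : Nonempty (Sylow p P) := inferInstance
  obtain ⟨g, hg⟩ := hR.exists_conj_mem_of_sup_eq_top hP S.normalizer_sup_eq_top
  have hmem : ∀ x, x ∈ ((S : Subgroup P).map P.subtype).map (MulAut.conj g).toMonoidHom ↔
      g⁻¹ * x * g ∈ (S : Subgroup P).map P.subtype := fun x => by
    rw [mem_map_equiv, MulAut.conj_symm_apply]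
  refine ⟨((S : Subgroup P).map P.subtype).map (MulAut.conj g).toMonoidHom, fun x hx => ?_, ?_,
    fun x hx m hm => ?_⟩
  · have h1 := ‹P.Normal›.conj_mem _ (map_subtype_le _ ((hmem x).mp hx)) g
    simpa [mul_assoc] using h1
  · rw [card_map_of_injective (MulAut.conj g).injective, card_map_of_injective P.subtype_injective]
    exact S.card_eq_multiplicity
  · rw [hmem] at hm ⊢
    have h1 := (mem_normalizer_iff.mp (hg x hx) _).mp hm
    simpa [mul_assoc] using h1

/-- If `H` is the only maximal subgroup containing the `r`-subgroup `R`, and `O_r(G) = 1`, then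
`L ∩ R = 1` for every normal subgroup `L ≤ H` such that `L ∩ R` is a Sylow subgroup of `L`. -/
theorem IsPGroup.inf_eq_bot_of_le_unique_coatom {G : Type*} [Group G] [Finite G] {r : ℕ}
    [Fact r.Prime] (hOr : ∀ Q : Subgroup G, Q.Normal → IsPGroup r Q → Q = ⊥)
    {R : Subgroup G} (hR : IsPGroup r R) {H : Subgroup G} (hH : IsCoatom H)
    (huniq : ∀ H' : Subgroup G, IsCoatom H' → R ≤ H' → H' = H) {L : Subgroup G} [L.Normal]
    (hLH : L ≤ H) (hidx : ¬ r ∣ ((L ⊓ R).subgroupOf L).index) : L ⊓ R = ⊥ := by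
  have hT : IsPGroup r (L ⊓ R : Subgroup G) := hR.to_inf_right
  let S : Sylow r L := hT.comap_subtype.toSylow hidx
  have hS : (S : Subgroup L).map L.subtype = L ⊓ R := by
    simp [S, subgroupOf_map_subtype, inf_comm]
  have hfr := S.normalizer_sup_eq_top
  rw [hS] at hfr
  have hRN : R ≤ normalizer ((L ⊓ R : Subgroup G) : Set G) :=
    le_normalizer_iff.mpr fun x hx y hy =>
      ⟨‹L.Normal›.conj_mem y hy.1 x, R.mul_mem (R.mul_mem hx hy.2) (R.inv_mem hx)⟩
  refine hOr _ (normalizer_eq_top_iff.mp ?_) hT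
  by_contra hne
  obtain ⟨M, hM, hNM⟩ := (eq_top_or_exists_le_coatom _).resolve_left hne
  obtain rfl := huniq M hM (hRN.trans hNM)
  exact hM.1 (top_le_iff.mp (hfr ▸ sup_le hNM hLH))


/-- Lemma 3.9: let `G` be a finite group with `O_r(G) = 1` and `O_{r'}(G) = P` not contained
in `Φ(G)`, and let `R` be a non-normal Sylow `r`-subgroup of `G` contained in a unique
maximal subgroup `H`. Then `P` is a `p`-group for some prime `p ≠ r`, `G = P ⋊ R`
(i.e. `P ⊔ R = ⊤` and `P ⊓ R = ⊥`), `R` acts faithfully and irreducibly on `P/Φ(P)`,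
`H = Φ(P)R`, and the normal core of `H` is `Φ(P) = Φ(G)`. -/
theorem stmt_11 {G : Type*} [Group G] [Finite G] {r : ℕ} (hr : r.Prime)
    (R : Sylow r G)
    (hOr : ∀ Q : Subgroup G, Q.Normal → IsPGroup r ↥Q → Q = ⊥)
    (P : Subgroup G) [P.Normal]
    (hPr' : Nat.Coprime (Nat.card P) r)
    (hPmax : ∀ Q : Subgroup G, Q.Normal → Nat.Coprime (Nat.card Q) r → Q ≤ P)
    (hPF : ¬ P ≤ frattini G)
    (hRnn : ¬ (R : Subgroup G).Normal)
    (H : Subgroup G) (hH : IsCoatom H) (hRH : (R : Subgroup G) ≤ H)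
    (huniq : ∀ H' : Subgroup G, IsCoatom H' → (R : Subgroup G) ≤ H' → H' = H) :
    (∃ p : ℕ, p.Prime ∧ p ≠ r ∧ IsPGroup p ↥P) ∧
    P ⊔ (R : Subgroup G) = ⊤ ∧
    P ⊓ (R : Subgroup G) = ⊥ ∧
    (∀ x ∈ (R : Subgroup G),
      (∀ y ∈ P, x * y * x⁻¹ * y⁻¹ ∈ (frattini ↥P).map P.subtype) → x = 1) ∧
    (∀ M : Subgroup G, (frattini ↥P).map P.subtype ≤ M → M ≤ P →
      (∀ x ∈ (R : Subgroup G), ∀ m ∈ M, x * m * x⁻¹ ∈ M) →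
      M = (frattini ↥P).map P.subtype ∨ M = P) ∧
    H = (frattini ↥P).map P.subtype ⊔ (R : Subgroup G) ∧
    H.normalCore = (frattini ↥P).map P.subtype ∧
    frattini G = (frattini ↥P).map P.subtype := by
  have : Fact r.Prime := ⟨hr⟩
  have hR : IsPGroup r (R : Subgroup G) := R.isPGroup'
  have hPH : ¬ P ≤ H := fun h => hPF (hR.le_frattini_of_le_unique_coatom huniq hPr' h)
  have hle : ∀ M : Subgroup G, M ≠ ⊤ → (R : Subgroup G) ≤ M → M ≤ H := fun M hM hRM => by
    obtain ⟨M', hM', hMM'⟩ := (eq_top_or_exists_le_coatom M).resolve_left hM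
    exact huniq M' hM' (hRM.trans hMM') ▸ hMM'
  have hPR : P ⊔ (R : Subgroup G) = ⊤ := by
    by_contra h
    exact hPH (le_sup_left.trans (hle _ h le_sup_right))
  have hdisj : P ⊓ (R : Subgroup G) = ⊥ := by
    obtain ⟨n, hn⟩ := IsPGroup.iff_card.mp hR
    refine (disjoint_of_coprime_natCard ?_).eq_bot
    rw [hn]
    exact hPr'.pow_right n
  have hinv : ∀ M : Subgroup G, M ≤ P →
      (∀ x ∈ (R : Subgroup G), ∀ m ∈ M, x * m * x⁻¹ ∈ M) → M ≠ P → M ≤ H := by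
    intro M hMP hM hne
    refine le_sup_left.trans (hle (M ⊔ (R : Subgroup G)) (fun htop => hne ?_) le_sup_right)
    refine le_antisymm hMP fun y hy => ?_
    have hy' : y ∈ ((M ⊔ (R : Subgroup G) : Subgroup G) : Set G) := by
      rw [htop]
      trivial
    rw [coe_mul_of_right_le_normalizer_left _ _ (le_normalizer_iff.mpr hM)] at hy'
    obtain ⟨m, hm, x, hx, rfl⟩ := hy'
    have hxP : x ∈ P ⊓ (R : Subgroup G) := ⟨(P.mul_mem_cancel_left (hMP hm)).mp hy, hx⟩
    rw [hdisj, mem_bot] at hxP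
    simpa [hxP] using hm
  obtain ⟨p, hp, hPp⟩ : ∃ p : ℕ, p.Prime ∧ IsPGroup p P := by
    by_contra hcon
    refine hPH (inf_eq_left.mp (eq_of_le_of_card_ge inf_le_left (Nat.le_of_dvd Nat.card_pos ?_)))
    rw [Nat.dvd_iff_prime_pow_dvd_dvd]
    intro p k hp hk
    have : Fact p.Prime := ⟨hp⟩
    obtain ⟨Q, hQP, hQ, hQinv⟩ := hR.exists_sylow_invariant hPr' p
    have hne : Q ≠ P := by
      rintro rfl
      exact hcon ⟨p, hp, IsPGroup.of_card hQ⟩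
    have hdvd := card_dvd_of_le (le_inf hQP (hinv Q hQP hQinv hne))
    rw [hQ] at hdvd
    exact (pow_dvd_pow p ((hp.pow_dvd_iff_le_factorization Nat.card_pos.ne').mp hk)).trans hdvd
  have : Fact p.Prime := ⟨hp⟩
  have hP1 : Nontrivial P := by
    rw [nontrivial_iff_ne_bot]
    rintro rfl
    exact hPF bot_le
  have hpP : p ∣ Nat.card P := by
    obtain ⟨n, hn, hn'⟩ := hPp.nontrivial_iff_card.mp hP1
    exact hn' ▸ dvd_pow_self p hn.ne'
  have hpr : p ≠ r := by
    rintro rfl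
    exact hp.one_lt.ne' (Nat.dvd_one.mp (hPr' ▸ Nat.dvd_gcd hpP dvd_rfl))
  have hpR : ¬ p ∣ Nat.card R := by
    obtain ⟨n, hn⟩ := IsPGroup.iff_card.mp hR
    rw [hn]
    exact fun h => hpr ((Nat.prime_dvd_prime_iff_eq hp hr).mp (hp.dvd_of_dvd_pow h))
  set F : Subgroup G := (frattini P).map P.subtype
  have hFn : F.Normal := inferInstance
  have hFP : F ≤ P := map_subtype_le _
  have hFH : F ≤ H := by
    refine hinv F hFP (fun x _ m hm => hFn.conj_mem m hm x) fun h => ?_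
    obtain ⟨M, hM, -⟩ := (eq_top_or_exists_le_coatom (⊥ : Subgroup P)).resolve_left bot_ne_top
    refine hM.1 (top_le_iff.mp (le_trans (fun x _ => ?_) (frattini_le_coatom hM)))
    obtain ⟨y, hy, hyx⟩ := h.ge x.2
    exact Subtype.ext hyx ▸ hy
  have hHP : H ⊓ P ≤ F := by
    obtain ⟨E, -, hEinv, hDE, hDE'⟩ := hPp.exists_invariant_complement_frattini hpR
      (MulAut.conjNormal.comp (R : Subgroup G).subtype) (H.subgroupOf P)
      (map_le_iff_le_comap.mp hFH)
      fun g a ha => H.mul_mem (H.mul_mem (hRH g.2) ha) (H.inv_mem (hRH g.2))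
    have hE : E = ⊤ := by
      by_contra hne
      have hEH : E.map P.subtype ≤ H := by
        refine hinv _ (map_subtype_le _) ?_ fun h => hne ?_
        · rintro x hx _ ⟨m, hm, rfl⟩
          exact ⟨_, hEinv ⟨x, hx⟩ m hm, rfl⟩
        · refine (eq_top_iff' E).mpr fun x => ?_
          obtain ⟨y, hy, hyx⟩ := h.ge x.2
          exact Subtype.ext hyx ▸ hy
      have hEH' : E ≤ H.subgroupOf P := map_le_iff_le_comap.mp hEH
      rw [sup_eq_left.mpr hEH', subgroupOf_eq_top] at hDE'
      exact hPH hDE'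
    rintro x ⟨hxH, hxP⟩
    rw [hE, inf_top_eq] at hDE
    exact ⟨⟨x, hxP⟩, hDE.le hxH, rfl⟩
  have hHF : H = F ⊔ (R : Subgroup G) := by
    refine le_antisymm (fun h hh => ?_) (sup_le hFH hRH)
    obtain ⟨y, hy, x, hx, rfl⟩ := mem_sup_of_normal_left.mp (hPR.ge (mem_top h))
    exact mul_mem_sup (hHP ⟨(H.mul_mem_cancel_right (hRH hx)).mp hh, hy⟩) hx
  have hFcop : (Nat.card F).Coprime r := hPr'.coprime_dvd_left (card_dvd_of_le hFP)
  have hcore : H.normalCore = F := by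
    have hFC : F ≤ H.normalCore := normal_le_normalCore.mpr hFH
    have hsup : H.normalCore ≤ F ⊔ (H.normalCore ⊓ (R : Subgroup G)) := by
      intro h hh
      obtain ⟨y, hy, x, hx, rfl⟩ := mem_sup_of_normal_left.mp (hHF.le (normalCore_le H hh))
      exact mul_mem_sup hy ⟨(mul_mem_cancel_left (hFC hy)).mp hh, hx⟩
    have hbot := hR.inf_eq_bot_of_le_unique_coatom hOr hH huniq (normalCore_le H) fun hd => by
      have htop : (H.normalCore ⊓ (R : Subgroup G)).subgroupOf H.normalCore ⊔
          F.subgroupOf H.normalCore = ⊤ := by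
        rw [← subgroupOf_sup inf_le_left hFC, subgroupOf_eq_top, sup_comm]
        exact hsup
      have hd' := hd.trans (index_dvd_card_of_sup_eq_top htop)
      rw [Nat.card_congr (subgroupOfEquivOfLe hFC).toEquiv] at hd'
      exact (Nat.Prime.coprime_iff_not_dvd hr).mp hFcop.symm hd'
    rw [hbot, sup_bot_eq] at hsup
    exact le_antisymm hsup hFC
  refine ⟨⟨p, hp, hpr, hPp⟩, hPR, hdisj, fun x hx hxP => ?_, fun M hFM hMP hM => ?_, hHF, hcore, ?_⟩
  · have hxC : x ∈ H.normalCore := fun g => by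
      obtain ⟨s, hs, y, hy, rfl⟩ := mem_sup_of_normal_right.mp
        ((sup_comm P (R : Subgroup G) ▸ hPR).ge (mem_top g))
      have h1 : y * x * y⁻¹ ∈ H := by
        have h2 := H.mul_mem (H.inv_mem (hFH (hxP y hy))) (hRH hx)
        simpa [mul_assoc] using h2
      have h3 := H.mul_mem (H.mul_mem (hRH hs) h1) (H.inv_mem (hRH hs))
      simpa [mul_assoc] using h3
    rw [hcore] at hxC
    exact mem_bot.mp (hdisj ▸ (⟨hFP hxC, hx⟩ : x ∈ P ⊓ (R : Subgroup G)))
  · by_contra! hne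
    exact hne.1 (le_antisymm ((le_inf (hinv M hMP hM hne.2) hMP).trans hHP) hFM)
  · refine le_antisymm ?_ (hR.le_frattini_of_le_unique_coatom huniq hFcop hFH)
    rw [← hcore]
    exact normal_le_normalCore.mpr (frattini_le_coatom hH)
end

section
/- Let G be an almost simple group with socle T, and let R be a Sylow r-subgroup of G such that R ∩ T = 1. Then R is contained in at least two maximal subgroups of G. -/
section Pointwise

open scoped Pointwise

/-- A Sylow subgroup meeting a normal subgroup trivially forces the order of the latter to be
prime to `r`. -/
theorem Sylow.not_dvd_card_of_inf_normal_eq_bot {G : Type*} [Group G] [Finite G] {r : ℕ}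
    [Fact r.Prime] (R : Sylow r G) (T : Subgroup G) [T.Normal]
    (h : (R : Subgroup G) ⊓ T = ⊥) : ¬ r ∣ Nat.card T := by
  intro hdvd
  obtain ⟨x, hx⟩ := exists_prime_orderOf_dvd_card' r hdvd
  have hx' : orderOf (x : G) = r := by rw [Subgroup.orderOf_coe, hx]
  have hp : IsPGroup r (Subgroup.zpowers (x : G)) :=
    IsPGroup.of_card (n := 1) (by rw [Nat.card_zpowers, hx', pow_one])
  obtain ⟨Q, hQ⟩ := hp.exists_le_sylow
  obtain ⟨g, rfl⟩ := MulAction.exists_smul_eq G R Q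
  have hxQ : (x : G) ∈ MulAut.conj g • (R : Subgroup G) := hQ (Subgroup.mem_zpowers _)
  rw [Subgroup.mem_pointwise_smul_iff_inv_smul_mem] at hxQ
  have hy : (MulAut.conj g)⁻¹ • (x : G) ∈ (R : Subgroup G) ⊓ T := by
    refine ⟨hxQ, ?_⟩
    rw [← map_inv]
    exact Subgroup.Normal.conj_mem inferInstance _ x.2 _
  rw [h, Subgroup.mem_bot, smul_eq_iff_eq_inv_smul, smul_one] at hy
  rw [hy, orderOf_one] at hx'
  exact (Fact.out : r.Prime).one_lt.ne hx'

/-- An `r`-subgroup normalizes some Sylow `p`-subgroup of any normal subgroup of order prime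
to `r`. -/
theorem IsPGroup.exists_sylow_le_normalizer {G : Type*} [Group G] [Finite G] {r p : ℕ}
    [Fact r.Prime] [Fact p.Prime] {R : Subgroup G} (hR : IsPGroup r R) (T : Subgroup G) [T.Normal]
    (h : ¬ r ∣ Nat.card T) :
    ∃ P : Sylow p T,
      R ≤ Subgroup.normalizer ((P : Subgroup T).map T.subtype : Set G) := by
  let : MulDistribMulAction R T :=
    MulDistribMulAction.compHom T ((MulAut.conjNormal (H := T)).comp R.subtype)
  have hcard : ¬ r ∣ Nat.card (Sylow p T) := by
    obtain ⟨P⟩ := (inferInstance : Nonempty (Sylow p T))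
    exact fun hd => h ((hd.trans P.card_dvd_index).trans (Subgroup.index_dvd_card _))
  obtain ⟨P, hP⟩ := hR.nonempty_fixed_point_of_prime_not_dvd_card (Sylow p T) hcard
  refine ⟨P, fun g hg => ?_⟩
  have key : ∀ g ∈ R, ∀ y ∈ (P : Subgroup T).map T.subtype,
      g * y * g⁻¹ ∈ (P : Subgroup T).map T.subtype := by
    rintro g hg _ ⟨y, hy, rfl⟩
    refine ⟨(⟨g, hg⟩ : R) • y, ?_, rfl⟩
    have h1 : (⟨g, hg⟩ : R) • (P : Subgroup T) = P := congrArg Sylow.toSubgroup (hP ⟨g, hg⟩)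
    have h2 := Subgroup.smul_mem_pointwise_smul y (⟨g, hg⟩ : R) (P : Subgroup T) hy
    rwa [h1] at h2
  rw [Subgroup.mem_normalizer_iff]
  refine fun y => ⟨key g hg y, fun hy => ?_⟩
  simpa [mul_assoc] using key g⁻¹ (inv_mem hg) _ hy

end Pointwise

/-- A subgroup of a finite group containing a Sylow `p`-subgroup for every prime `p` is
everything. -/
theorem Subgroup.eq_top_of_forall_exists_sylow_le {G : Type*} [Group G] [Finite G]
    (H : Subgroup G) (h : ∀ p : ℕ, p.Prime → ∃ P : Sylow p G, (P : Subgroup G) ≤ H) :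
    H = ⊤ := by
  rw [← Subgroup.index_eq_one]
  by_contra hne
  obtain ⟨p, hp, hd⟩ := Nat.exists_prime_and_dvd hne
  have := Fact.mk hp
  obtain ⟨P, hP⟩ := h p hp
  exact P.not_dvd_index (hd.trans (Subgroup.index_dvd_of_le hP))

/-- The normalizer of a nontrivial Sylow subgroup of a nonabelian simple normal subgroup is
proper. -/
theorem Sylow.normalizer_map_subtype_ne_top {G : Type*} [Group G] [Finite G] (T : Subgroup G)
    (hsimple : IsSimpleGroup T) (hnonab : ∃ a b : T, a * b ≠ b * a) {p : ℕ} [Fact p.Prime]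
    (hp : p ∣ Nat.card T) (P : Sylow p T) :
    Subgroup.normalizer ((P : Subgroup T).map T.subtype : Set G) ≠ ⊤ := by
  intro htop
  have hn : ((P : Subgroup T).map T.subtype).Normal := Subgroup.normalizer_eq_top_iff.mp htop
  have hPn : (P : Subgroup T).Normal := by
    have := hn.comap T.subtype
    rwa [Subgroup.comap_map_eq_self_of_injective T.subtype_injective] at this
  rcases hPn.eq_bot_or_eq_top with hb | ht
  · exact P.ne_bot_of_dvd_card hp hb
  · have hT : IsPGroup p T := (ht ▸ P.isPGroup' : IsPGroup p (⊤ : Subgroup T)).of_equiv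
      Subgroup.topEquiv
    have := hT.isNilpotent
    obtain ⟨a, b, hab⟩ := hnonab
    exact hab (IsSimpleGroup.comm_iff_isSolvable.mpr inferInstance a b)


/-- Lemma 2.2: let `G` be an almost simple group with socle `T` (a nonabelian simple normal
subgroup with trivial centralizer) and let `R` be a Sylow `r`-subgroup of `G` with
`R ⊓ T = 1`. Then `R` is contained in at least two maximal subgroups of `G`. -/
theorem stmt_12 {G : Type*} [Group G] [Finite G] (T : Subgroup G) [T.Normal]
    (hsimple : IsSimpleGroup ↥T) (hnonab : ∃ a b : ↥T, a * b ≠ b * a)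
    (hcent : Subgroup.centralizer (T : Set G) = ⊥)
    {r : ℕ} (hr : r.Prime) (R : Sylow r G)
    (hRT : (R : Subgroup G) ⊓ T = ⊥) :
    ∃ H₁ H₂ : Subgroup G, H₁ ≠ H₂ ∧
      IsCoatom H₁ ∧ IsCoatom H₂ ∧
      (R : Subgroup G) ≤ H₁ ∧ (R : Subgroup G) ≤ H₂ := by
  have := Fact.mk hr
  have hrT := R.not_dvd_card_of_inf_normal_eq_bot T hRT
  have hnormalizer (p : ℕ) [Fact p.Prime] : ∃ P : Sylow p T,
      (R : Subgroup G) ≤ Subgroup.normalizer ((P : Subgroup T).map T.subtype : Set G) :=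
    R.isPGroup'.exists_sylow_le_normalizer T hrT
  have hproper {p : ℕ} [Fact p.Prime] (hp : p ∣ Nat.card T) (P : Sylow p T) :=
    P.normalizer_map_subtype_ne_top T hsimple hnonab hp
  obtain ⟨q, hq, hqT⟩ := Nat.exists_prime_and_dvd (Finite.one_lt_card (α := T)).ne'
  have := Fact.mk hq
  obtain ⟨Q, hRQ⟩ := hnormalizer q
  obtain ⟨M, hM, hQM⟩ := (eq_top_or_exists_le_coatom _).resolve_left (hproper hqT Q)
  by_contra! hunique
  have hMle : ∀ p : ℕ, p.Prime → ∃ P : Sylow p T, (P : Subgroup T) ≤ M.subgroupOf T := by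
    intro p hp
    have := Fact.mk hp
    obtain ⟨P, hRP⟩ := hnormalizer p
    refine ⟨P, ?_⟩
    by_cases hpT : p ∣ Nat.card T
    · obtain ⟨N, hN, hPN⟩ := (eq_top_or_exists_le_coatom _).resolve_left (hproper hpT P)
      have hMN : M = N := by
        by_contra hne
        exact hunique M N hne hM hN (hRQ.trans hQM) (hRP.trans hPN)
      rw [Subgroup.subgroupOf, ← Subgroup.map_le_iff_le_comap, hMN]
      exact Subgroup.le_normalizer.trans hPN
    · have hbot : (P : Subgroup T) = ⊥ := by
        by_contra hne
        obtain ⟨n, hn, hcard⟩ := (P.isPGroup'.nontrivial_iff_card).mp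
          ((Subgroup.nontrivial_iff_ne_bot _).mpr hne)
        exact hpT ((hcard ▸ dvd_pow_self p hn.ne').trans (Subgroup.card_subgroup_dvd_card _))
      rw [hbot]
      exact bot_le
  have hTM : T ≤ M := Subgroup.subgroupOf_eq_top.mp
    (Subgroup.eq_top_of_forall_exists_sylow_le _ hMle)
  refine hM.1 (top_le_iff.mp ?_)
  rw [← Sylow.normalizer_sup_eq_top Q]
  exact sup_le hQM hTM
end
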